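/- For every integer n ≥ 13 the following identity holds in ℚ: Σ_{ℓ=3}^{⌊(n−1)/2⌋} (−1)^{ℓ} · C(n−ℓ−3, ℓ−2) · 3/(C(ℓ,2)·C(2ℓ−1, ℓ−1)) = −(n−5)(n−6)/((n−2)(n−3)). -/

import Mathlib

/-- The summand of the identity. -/
def psTerm (n l : ℕ) : ℚ :=
  (-1 : ℚ) ^ l * ((n - l - 3).choose (l - 2) : ℚ) *
        (3 / ((l.choose 2 : ℚ) * ((2 * l - 1).choose (l - 1) : ℚ)))

lemma psTerm_binom (b k : ℕ) (h : k ≤ b + 1) :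
    ((b.choose (k + 1) : ℕ) : ℚ) * (b + 1) * (k + 1)
      = ((b : ℚ) + 1 - k) * (b - k) * ((b + 1).choose k : ℕ) := by
  rcases Nat.lt_or_ge b k with h' | h'
  · have : k = b + 1 := by omega
    subst this
    rw [Nat.choose_eq_zero_of_lt (by omega : b < b + 1 + 1)]
    push_cast
    ring
  · have h1 := Nat.choose_succ_right_eq b k
    have h2 := Nat.choose_mul_succ_eq b k
    have h1' : ((b.choose (k + 1) : ℕ) : ℚ) * (k + 1) = (b.choose k : ℕ) * ((b : ℚ) - k) := by
      rw [← Nat.cast_sub h']; exact_mod_cast h1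
    have h2' : ((b.choose k : ℕ) : ℚ) * (b + 1) = ((b + 1).choose k : ℕ) * ((b : ℚ) + 1 - k) := by
      have : ((b : ℚ) + 1 - k) = ((b + 1 - k : ℕ) : ℚ) := by rw [Nat.cast_sub h]; push_cast; ring
      rw [this]; exact_mod_cast h2
    linear_combination (b + 1 : ℚ) * h1' + ((b : ℚ) - k) * h2'

lemma psTerm_central (p : ℕ) :
    (((2 * p + 3).choose (p + 1) : ℕ) : ℚ) * (p + 2)
      = 2 * (2 * p + 3) * ((2 * p + 1).choose p : ℕ) := by
  have h1 := Nat.add_one_mul_choose_eq (2 * p + 2) p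
  have h2 := Nat.choose_mul_succ_eq (2 * p + 1) p
  rw [show 2 * p + 1 + 1 - p = p + 2 by omega] at h2
  have h1' : (2 * p + 3 : ℚ) * ((2 * p + 2).choose p : ℕ)
      = ((2 * p + 3).choose (p + 1) : ℕ) * (p + 1) := by exact_mod_cast h1
  have h2' : (((2 * p + 1).choose p : ℕ) : ℚ) * (2 * p + 2)
      = ((2 * p + 2).choose p : ℕ) * (p + 2) := by exact_mod_cast h2
  have hp : (p + 1 : ℚ) ≠ 0 := by positivity
  apply mul_right_cancel₀ hp
  linear_combination (-(p : ℚ) - 2) * h1' - (2 * p + 3 : ℚ) * h2'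

lemma psTerm_rec (n l : ℕ) (hl : 2 ≤ l) (h : 2 * l + 1 ≤ n) (hn : 6 ≤ n) :
    2 * (2 * (l : ℚ) + 1) * (n - l - 3) * psTerm n (l + 1)
      = -((n : ℚ) - 2 * l - 1) * (n - 2 * l - 2) * psTerm n l := by
  obtain ⟨k, rfl⟩ : ∃ k, l = k + 2 := ⟨l - 2, by omega⟩
  obtain ⟨b, rfl⟩ : ∃ b, n = b + k + 6 := ⟨n - k - 6, by omega⟩
  have hb := psTerm_binom b k (by omega)
  have hc := psTerm_central (k + 1)
  unfold psTerm
  rw [show b + k + 6 - (k + 2 + 1) - 3 = b by omega, show k + 2 + 1 - 2 = k + 1 by omega,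
    show b + k + 6 - (k + 2) - 3 = b + 1 by omega, show k + 2 - 2 = k by omega,
    show 2 * (k + 2 + 1) - 1 = 2 * (k + 1) + 3 by omega, show k + 2 + 1 - 1 = k + 1 + 1 by omega,
    show 2 * (k + 2) - 1 = 2 * (k + 1) + 1 by omega, show k + 2 - 1 = k + 1 by omega,
    Nat.cast_choose_two, Nat.cast_choose_two]
  have hpos : (0 : ℚ) < ((2 * (k + 1) + 1).choose (k + 1) : ℕ) := by
    exact_mod_cast Nat.choose_pos (by omega)
  generalize (((2 * (k + 1) + 1).choose (k + 1) : ℕ) : ℚ) = X at *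
  have hY : (((2 * (k + 1) + 3).choose (k + 1 + 1) : ℕ) : ℚ) = 2 * (2 * k + 5) * X / (k + 3) := by
    rw [eq_div_iff (by positivity)]
    push_cast at hc
    linear_combination hc
  have hB : ((b.choose (k + 1) : ℕ) : ℚ)
      = ((b : ℚ) + 1 - k) * (b - k) * ((b + 1).choose k : ℕ) / ((b + 1) * (k + 1)) := by
    rw [eq_div_iff (by positivity)]
    linear_combination hb
  rw [hY, hB]
  generalize (((b + 1).choose k : ℕ) : ℚ) = Z
  push_cast
  rw [show (k : ℚ) + 2 + 1 - 1 = k + 2 by ring, show (k : ℚ) + 2 - 1 = k + 1 by ring,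
    show (b : ℚ) + k + 6 - (k + 2) - 3 = b + 1 by ring, pow_succ]
  have h1 : (k : ℚ) + 1 ≠ 0 := by positivity
  have h2 : (k : ℚ) + 2 ≠ 0 := by positivity
  have h3 : (k : ℚ) + 3 ≠ 0 := by positivity
  have h5 : 2 * (k : ℚ) + 5 ≠ 0 := by positivity
  have hb1 : (b : ℚ) + 1 ≠ 0 := by positivity
  rw [show (k : ℚ) + 2 + 1 = k + 3 by ring, show 2 * ((k : ℚ) + 2) + 1 = 2 * k + 5 by ring]
  have := hpos.ne'
  field_simp
  ring

lemma psTerm_sum (n : ℕ) (hn : 6 ≤ n) (q : ℕ) (h : 2 * (q + 2) + 1 ≤ n) :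
    ((n : ℚ) - 2) * (n - 3) * ∑ l ∈ Finset.Icc 3 (q + 2), psTerm n l
      = -((n - 5) * (n - 6)) - 2 * (2 * (q : ℚ) + 5) * (n - q - 5) * psTerm n (q + 3) := by
  induction q with
  | zero =>
    have h3 : psTerm n 3 = -((n : ℚ) - 6) / 10 := by
      unfold psTerm
      rw [show n - 3 - 3 = n - 6 by omega]
      have : Nat.choose 3 2 = 3 := by decide
      have h' : Nat.choose 5 2 = 10 := by decide
      norm_num [this, h', Nat.cast_sub hn]
      ring
    simp [h3]
    ring
  | succ q ih =>
    rw [show q + 1 + 2 = (q + 2) + 1 by ring, Finset.sum_Icc_succ_top (by omega), mul_add,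
      ih (by omega)]
    have := psTerm_rec n (q + 3) (by omega) (by omega) hn
    rw [show q + 2 + 1 = q + 3 by ring, show q + 1 + 3 = q + 3 + 1 by ring]
    push_cast at this ⊢
    linear_combination this

/-- Pfaff–Saalschütz type identity: for all `n ≥ 13`,
`∑_{ℓ=3}^{⌊(n-1)/2⌋} (-1)^{ℓ}·C(n-ℓ-3, ℓ-2)·3/(C(ℓ,2)·C(2ℓ-1,ℓ-1))
  = -(n-5)(n-6)/((n-2)(n-3))`. -/
theorem pfaff_saalschuetz_identity_three (n : ℕ) (hn : 13 ≤ n) :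
    ∑ ℓ ∈ Finset.Icc 3 ((n - 1) / 2),
      (-1 : ℚ) ^ ℓ * ((n - ℓ - 3).choose (ℓ - 2) : ℚ) *
        (3 / ((ℓ.choose 2 : ℚ) * ((2 * ℓ - 1).choose (ℓ - 1) : ℚ))) =
      -(((n : ℚ) - 5) * ((n : ℚ) - 6)) / (((n : ℚ) - 2) * ((n : ℚ) - 3)) := by
  obtain ⟨q, hq⟩ : ∃ q, (n - 1) / 2 = q + 2 := ⟨(n - 1) / 2 - 2, by omega⟩
  have h := psTerm_sum n (by omega) q (by omega)
  have h0 : psTerm n (q + 3) = 0 := by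
    unfold psTerm
    rw [Nat.choose_eq_zero_of_lt (by omega : n - (q + 3) - 3 < q + 3 - 2)]
    simp
  have hn' : (13 : ℚ) ≤ n := by exact_mod_cast hn
  rw [hq, eq_div_iff (mul_ne_zero (by linarith) (by linarith))]
  rw [h0, mul_zero, sub_zero] at h
  rw [← h, mul_comm]
  rfl
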